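/- For every p_0 < 1 and every ε > 0, there exists a constant C such that the following holds. Let V be a finite set, let p ∈ (0, p_0], let Y = (Y_v)_{v∈V} be i.i.d. Bernoulli(p) random variables, let f : {0,1}^V → [0,∞) be an arbitrary increasing (monotone nondecreasing in each coordinate) function, and set X := f(Y). Then, for every nonnegative real η, −log Pr(X ≤ η·E[X]) ≤ (1+ε)·Φ_p^f((1−ε)η) + C. -/

import Mathlib

open Classical

noncomputable section

/-- The probability of the configuration `ω ⊆ V` under the product measure in which
each vertex `v` is retained independently with probability `q v`. -/
def pw {V : Type*} [Fintype V] [DecidableEq V] (q : V → ℝ) (ω : Finset V) : ℝ :=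
  (∏ v ∈ ω, q v) * ∏ v ∈ ωᶜ, (1 - q v)

/-- The relative entropy `i_p(q) = D_KL(Ber(q) ‖ Ber(p))`.  (In Lean `Real.log 0 = 0`,
which implements the convention `0 · log 0 = 0`.) -/
def ip (p q : ℝ) : ℝ :=
  q * Real.log (q / p) + (1 - q) * Real.log ((1 - q) / (1 - p))

/-- `E[f(Y^{(q)})]`: the expectation of `f : {0,1}^V → ℝ` (identifying subsets of `V` with
Boolean vectors) over independent Bernoulli variables with success probabilities `q`. -/
def expF {V : Type*} [Fintype V] [DecidableEq V] (f : Finset V → ℝ) (q : V → ℝ) : ℝ :=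
  ∑ ω : Finset V, pw q ω * f ω

lemma ip_eq_klFun {p : ℝ} (hp : 0 < p) (hp1 : p < 1) (q : ℝ) :
    ip p q = p * InformationTheory.klFun (q / p) +
      (1 - p) * InformationTheory.klFun ((1 - q) / (1 - p)) := by
  have h1 : 1 - p ≠ 0 := by linarith
  have e1 : p * (q / p) = q := by field_simp
  have e2 : (1 - p) * ((1 - q) / (1 - p)) = 1 - q := by field_simp
  unfold ip InformationTheory.klFun
  linear_combination (1 - Real.log (q / p)) * e1 +
    (1 - Real.log ((1 - q) / (1 - p))) * e2

lemma ip_nonneg {p q : ℝ} (hp : 0 < p) (hp1 : p < 1) (hq : 0 ≤ q) (hq1 : q ≤ 1) :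
    0 ≤ ip p q := by
  rw [ip_eq_klFun hp hp1]
  have h1 : 0 < 1 - p := by linarith
  have := InformationTheory.klFun_nonneg (div_nonneg hq hp.le)
  have := InformationTheory.klFun_nonneg (div_nonneg (sub_nonneg.2 hq1) h1.le)
  positivity

lemma ip_self {p : ℝ} (hp : 0 < p) (hp1 : p < 1) : ip p p = 0 := by
  have h1 : 1 - p ≠ 0 := by linarith
  simp [ip, hp.ne', h1]

lemma sq_le_mul_exp_neg {t T : ℝ} (hT : 0 ≤ T) (ht : t ≤ T) :
    t ^ 2 ≤ (4 + 2 * T) * (t - 1 + Real.exp (-t)) := by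
  have h0 : 0 ≤ t - 1 + Real.exp (-t) := by linarith [Real.add_one_le_exp (-t)]
  rcases le_total t 0 with h | h
  · have := Real.quadratic_le_exp_of_nonneg (neg_nonneg.2 h)
    nlinarith
  · rcases le_total t 2 with h2 | h2
    · have h3 := Real.add_one_le_exp (-t / 2)
      have h4 : Real.exp (-t) = Real.exp (-t / 2) ^ 2 := by
        rw [← Real.exp_nat_mul]; congr 1; push_cast; ring
      have h5 : (1 - t / 2) ^ 2 ≤ Real.exp (-t / 2) ^ 2 :=
        pow_le_pow_left₀ (by linarith) (by linarith) 2
      nlinarith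
    · have := Real.exp_pos (-t)
      have h6 : t / 2 ≤ t - 1 + Real.exp (-t) := by linarith
      nlinarith

lemma mul_log_sq_le_klFun {x T : ℝ} (hT : 0 ≤ T) (hx : 0 ≤ x) (hxT : Real.log x ≤ T) :
    x * Real.log x ^ 2 ≤ (4 + 2 * T) * InformationTheory.klFun x := by
  rcases hx.eq_or_lt with rfl | hx
  · simp [InformationTheory.klFun_zero]; linarith
  · have h := mul_le_mul_of_nonneg_left (sq_le_mul_exp_neg hT hxT) hx.le
    rw [Real.exp_neg, Real.exp_log hx] at h
    have e : x * x⁻¹ = 1 := mul_inv_cancel₀ hx.ne'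
    unfold InformationTheory.klFun
    linear_combination h + (4 + 2 * T) * e

lemma exp_le_one_add_add_sq {u : ℝ} (hu : u ≤ 1) : Real.exp u ≤ 1 + u + u ^ 2 := by
  rcases le_total (-1) u with h | h
  · have := (abs_le.1 (Real.abs_exp_sub_one_sub_id_le (abs_le.2 ⟨h, hu⟩))).2
    linarith
  · have : Real.exp u ≤ 1 := Real.exp_le_one_iff.2 (by linarith)
    nlinarith

lemma mul_rpow_le_klFun {x T s δ : ℝ} (hT : 0 ≤ T) (hx : 0 ≤ x) (hxT : Real.log x ≤ T)
    (hs : 0 < s) (hsT : s * T ≤ 1) (hsδ : s * (4 + 2 * T) ≤ δ) :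
    x * x ^ s ≤ x + s * (x * Real.log x) + s * δ * InformationTheory.klFun x := by
  have h1 : x * x ^ s ≤ x + s * (x * Real.log x) + s ^ 2 * (x * Real.log x ^ 2) := by
    rcases hx.eq_or_lt with rfl | hx
    · simp
    · have h := exp_le_one_add_add_sq
        ((mul_le_mul_of_nonneg_left hxT hs.le).trans hsT)
      rw [Real.rpow_def_of_pos hx, mul_comm (Real.log x)]
      have := mul_le_mul_of_nonneg_left h hx.le
      linarith
  have h2 := mul_le_mul_of_nonneg_left (mul_log_sq_le_klFun hT hx hxT) (sq_nonneg s)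
  have h3 := mul_le_mul_of_nonneg_left
    (mul_le_mul_of_nonneg_right hsδ (InformationTheory.klFun_nonneg hx)) hs.le
  linarith

lemma bernoulli_moment_le {p₀ p q T s δ : ℝ} (hp : 0 < p) (hpp : p ≤ p₀) (hp₀ : p₀ < 1)
    (hq : 0 ≤ q) (hqp : q ≤ p) (hT : T = Real.log (1 / (1 - p₀)))
    (hs : 0 < s) (hsT : s * T ≤ 1) (hsδ : s * (4 + 2 * T) ≤ δ) :
    q * (q / p) ^ s + (1 - q) * ((1 - q) / (1 - p)) ^ s ≤
      Real.exp (s * ((1 + δ) * ip p q)) := by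
  have h1 : 0 < 1 - p := by linarith
  have h10 : 0 < 1 - p₀ := by linarith
  have hT0 : 0 ≤ T := by
    rw [hT]
    exact Real.log_nonneg ((one_le_div h10).2 (by linarith))
  have ha : 0 ≤ q / p := div_nonneg hq hp.le
  have hb : 0 < (1 - q) / (1 - p) := div_pos (by linarith) h1
  have haT : Real.log (q / p) ≤ T :=
    (Real.log_nonpos ha ((div_le_one hp).2 hqp)).trans hT0
  have hbT : Real.log ((1 - q) / (1 - p)) ≤ T := by
    rw [hT]
    exact Real.log_le_log hb (div_le_div₀ zero_le_one (by linarith) h10 (by linarith))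
  have k1 := mul_le_mul_of_nonneg_left (mul_rpow_le_klFun hT0 ha haT hs hsT hsδ) hp.le
  have k2 := mul_le_mul_of_nonneg_left (mul_rpow_le_klFun hT0 hb.le hbT hs hsT hsδ) h1.le
  have e1 : p * (q / p) = q := by field_simp
  have e2 : (1 - p) * ((1 - q) / (1 - p)) = 1 - q := by field_simp
  have e3 := ip_eq_klFun hp (by linarith) q
  have e4 : ip p q = q * Real.log (q / p) + (1 - q) * Real.log ((1 - q) / (1 - p)) := rfl
  refine le_trans ?_ (Real.add_one_le_exp _)
  generalize Real.log (q / p) = la at *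
  generalize Real.log ((1 - q) / (1 - p)) = lb at *
  generalize InformationTheory.klFun (q / p) = ka at *
  generalize InformationTheory.klFun ((1 - q) / (1 - p)) = kb at *
  generalize (q / p) ^ s = as at *
  generalize ((1 - q) / (1 - p)) ^ s = bs at *
  generalize q / p = a at *
  generalize (1 - q) / (1 - p) = b at *
  subst e1
  have e5 : (1 - p) * (b * bs) = (1 - p * a) * bs := by rw [← e2]; ring
  have e6 : (1 - p) * (b * lb) = (1 - p * a) * lb := by rw [← e2]; ring
  linear_combination k1 + k2 - e5 + s * e6 + e2 - s * e4 - s * δ * e3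

section

variable {V : Type*} [Fintype V] [DecidableEq V]

lemma sum_prod_mul_prod_compl (x y : V → ℝ) :
    ∑ ω : Finset V, (∏ v ∈ ω, x v) * ∏ v ∈ ωᶜ, y v = ∏ v, (x v + y v) := by
  rw [Finset.prod_add, Finset.powerset_univ]
  rfl

lemma sum_pw (q : V → ℝ) : ∑ ω, pw q ω = 1 := by
  unfold pw
  rw [sum_prod_mul_prod_compl]
  simp

lemma pw_eq_prod_ite (q : V → ℝ) (ω : Finset V) :
    pw q ω = ∏ v, if v ∈ ω then q v else 1 - q v := by
  rw [Finset.prod_ite, pw]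
  congr 1 <;> refine Finset.prod_congr ?_ fun _ _ => rfl <;> ext <;> simp

lemma pw_nonneg {q : V → ℝ} (hq : ∀ v, q v ∈ Set.Icc (0 : ℝ) 1) (ω : Finset V) :
    0 ≤ pw q ω :=
  mul_nonneg (Finset.prod_nonneg fun v _ => (hq v).1)
    (Finset.prod_nonneg fun v _ => sub_nonneg.2 (hq v).2)

lemma expF_mono {f : Finset V → ℝ} (hf : ∀ ω, 0 ≤ f ω) (hf' : Monotone f) {q r : V → ℝ}
    (hq : ∀ v, q v ∈ Set.Icc (0 : ℝ) 1) (hr : ∀ v, r v ∈ Set.Icc (0 : ℝ) 1)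
    (hqr : ∀ v, q v ≤ r v) : expF f q ≤ expF f r := by
  have h := holley (α := Finset V) (f := pw q) (g := pw r) (μ := f)
    hf (pw_nonneg hq) (pw_nonneg hr) hf' (by rw [sum_pw, sum_pw]) ?_
  · unfold expF
    simpa only [mul_comm] using h
  · intro a b
    simp only [pw_eq_prod_ite, ← Finset.prod_mul_distrib]
    refine Finset.prod_le_prod (fun v _ => ?_) (fun v _ => ?_)
    · have := hq v; have := hr v
      simp only [Set.mem_Icc] at *
      split_ifs <;> apply mul_nonneg <;> linarith
    · have := hq v; have := hr v; have := hqr v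
      simp only [Set.mem_Icc, Finset.inf_eq_inter, Finset.sup_eq_union, Finset.mem_inter,
        Finset.mem_union] at *
      by_cases ha : v ∈ a <;> by_cases hb : v ∈ b <;> simp [ha, hb] <;> nlinarith

/-- Markov inequality for the product measure. -/
lemma le_sum_pw_of_expF_le {f : Finset V → ℝ} (hf : ∀ ω, 0 ≤ f ω) {q : V → ℝ}
    (hq : ∀ v, q v ∈ Set.Icc (0 : ℝ) 1) {a δ : ℝ} (ha : 0 ≤ a) (hδ1 : δ ≤ 1)
    (h : expF f q ≤ (1 - δ) * a) :
    δ ≤ ∑ ω, if f ω ≤ a then pw q ω else 0 := by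
  have hQ := pw_nonneg hq
  rcases ha.eq_or_lt with rfl | ha
  · have h0 : ∑ ω, pw q ω * f ω = 0 := by
      refine le_antisymm (by simpa [expF] using h) (Finset.sum_nonneg fun ω _ =>
        mul_nonneg (hQ ω) (hf ω))
    rw [Finset.sum_eq_zero_iff_of_nonneg fun ω _ => mul_nonneg (hQ ω) (hf ω)] at h0
    have : ∑ ω, (if f ω ≤ 0 then pw q ω else 0) = ∑ ω, pw q ω := by
      refine Finset.sum_congr rfl fun ω hω => ?_
      split_ifs with h1
      · rfl
      · rcases mul_eq_zero.1 (h0 ω hω) with h2 | h2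
        · exact h2.symm
        · exact absurd h2.le h1
    rw [this, sum_pw]
    exact hδ1
  · have h1 : a * ∑ ω, pw q ω ≤
        a * (∑ ω, if f ω ≤ a then pw q ω else 0) + ∑ ω, pw q ω * f ω := by
      rw [Finset.mul_sum, Finset.mul_sum, ← Finset.sum_add_distrib]
      refine Finset.sum_le_sum fun ω _ => ?_
      have := hQ ω
      have := mul_nonneg (hQ ω) (hf ω)
      split_ifs with h2
      · linarith
      · nlinarith [not_le.1 h2]
    rw [sum_pw] at h1
    have h2 : a * δ ≤ a * ∑ ω, if f ω ≤ a then pw q ω else 0 := by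
      unfold expF at h
      linarith
    exact le_of_mul_le_mul_left h2 ha

/-- Change of measure: an event of probability at least `δ` under the measure `q` has
probability under the measure `p` controlled by the moments of the likelihood ratio. -/
lemma sum_pw_le_mul_add_prod {p s M : ℝ} (hp : 0 < p) (hp1 : p < 1) {q : V → ℝ}
    (hq : ∀ v, q v ∈ Set.Icc (0 : ℝ) 1) (hs : 0 < s) (hM : 0 < M) (A : Finset V → Prop) :
    ∑ ω, (if A ω then pw q ω else 0) ≤
      M * ∑ ω, (if A ω then pw (fun _ => p) ω else 0) +
      (∏ v, (q v * (q v / p) ^ s + (1 - q v) * ((1 - q v) / (1 - p)) ^ s)) / M ^ s := by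
  have h1 : 0 < 1 - p := by linarith
  have hP := pw_nonneg (V := V) (q := fun _ => p) fun _ => ⟨hp.le, hp1.le⟩
  have hQ := pw_nonneg hq
  have hx : ∀ v, 0 ≤ q v / p := fun v => div_nonneg (hq v).1 hp.le
  have hy : ∀ v, 0 ≤ (1 - q v) / (1 - p) := fun v => div_nonneg (sub_nonneg.2 (hq v).2) h1.le
  let r : Finset V → ℝ := fun ω => (∏ v ∈ ω, q v / p) * ∏ v ∈ ωᶜ, (1 - q v) / (1 - p)
  have hr : ∀ ω, 0 ≤ r ω := fun ω =>
    mul_nonneg (Finset.prod_nonneg fun v _ => hx v) (Finset.prod_nonneg fun v _ => hy v)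
  have hPr : ∀ ω, pw q ω = pw (fun _ => p) ω * r ω := fun ω => by
    simp only [pw, r]
    rw [mul_mul_mul_comm, ← Finset.prod_mul_distrib, ← Finset.prod_mul_distrib]
    congr 1 <;> refine Finset.prod_congr rfl fun v _ => ?_ <;> field_simp
  have hrs : ∀ ω, pw q ω * r ω ^ s = (∏ v ∈ ω, q v * (q v / p) ^ s) *
      ∏ v ∈ ωᶜ, (1 - q v) * ((1 - q v) / (1 - p)) ^ s := fun ω => by
    simp only [pw, r]
    rw [Real.mul_rpow (Finset.prod_nonneg fun v _ => hx v) (Finset.prod_nonneg fun v _ => hy v),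
      ← Real.finsetProd_rpow _ _ (fun v _ => hx v),
      ← Real.finsetProd_rpow _ _ (fun v _ => hy v), mul_mul_mul_comm,
      ← Finset.prod_mul_distrib, ← Finset.prod_mul_distrib]
  rw [← sum_prod_mul_prod_compl, Finset.mul_sum, Finset.sum_div, ← Finset.sum_add_distrib]
  refine Finset.sum_le_sum fun ω _ => ?_
  rw [← hrs, mul_div_assoc, ← Real.div_rpow (hr ω) hM.le]
  have h3 : 0 ≤ pw q ω * (r ω / M) ^ s :=
    mul_nonneg (hQ ω) (Real.rpow_nonneg (div_nonneg (hr ω) hM.le) s)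
  split_ifs
  · rcases le_total (r ω) M with h | h
    · have := mul_le_mul_of_nonneg_left h (hP ω)
      rw [← hPr] at this
      linarith
    · have := mul_le_mul_of_nonneg_left
        (Real.one_le_rpow ((one_le_div hM).2 h) hs.le) (hQ ω)
      have := mul_nonneg hM.le (hP ω)
      linarith
  · linarith

end

/-- Theorem `thm:lower-bound`: for every `p₀ < 1` and `ε > 0`, there is a constant `C`
such that for every finite set `V`, every `p ∈ (0, p₀]`, every nonnegative increasing
function `f : {0,1}^V → [0, ∞)`, and every `η ≥ 0`,
`− log Pr(f(Y) ≤ η E[f(Y)]) ≤ (1+ε) Φ_p^f((1−ε)η) + C`, where `Y` is i.i.d. `Ber(p)`.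
The minimum `Φ_p^f((1−ε)η)` is rendered by quantifying over all product measures `q`
that satisfy the constraint `E[f(Y^{(q)})] ≤ (1−ε)η E[f(Y)]` (so that the statement is also
correct, i.e. vacuous, when no such `q` exists and the minimum is `+∞`). -/
theorem lower_bound_for_lower_tail (p₀ ε : ℝ) (hp₀ : p₀ < 1) (hε : 0 < ε) :
    ∃ C : ℝ, ∀ (V : Type) [Fintype V] [DecidableEq V] (p : ℝ), 0 < p → p ≤ p₀ →
      ∀ f : Finset V → ℝ, (∀ ω, 0 ≤ f ω) → (∀ ω₁ ω₂, ω₁ ⊆ ω₂ → f ω₁ ≤ f ω₂) →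
      ∀ η : ℝ, 0 ≤ η →
      ∀ q : V → ℝ, (∀ v, q v ∈ Set.Icc (0 : ℝ) 1) →
        expF f q ≤ (1 - ε) * η * expF f (fun _ => p) →
        - Real.log (∑ ω : Finset V,
              if f ω ≤ η * expF f (fun _ => p) then pw (fun _ => p) ω else 0)
          ≤ (1 + ε) * (∑ v, ip p (q v)) + C := by
  rcases le_or_gt p₀ 0 with h0 | h0
  · exact ⟨0, fun V _ _ p hp hpp => absurd (hp.trans_le hpp) (not_lt.2 h0)⟩
  obtain ⟨T, hT⟩ : ∃ T, T = Real.log (1 / (1 - p₀)) := ⟨_, rfl⟩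
  have hT0 : 0 ≤ T := by
    rw [hT]
    exact Real.log_nonneg ((one_le_div (by linarith)).2 (by linarith))
  obtain ⟨δ, hδ⟩ : ∃ δ, δ = min ε 1 := ⟨_, rfl⟩
  have hδ0 : 0 < δ := by rw [hδ]; positivity
  have hδε : δ ≤ ε := hδ ▸ min_le_left _ _
  have hδ1 : δ ≤ 1 := hδ ▸ min_le_right _ _
  obtain ⟨s, hs⟩ : ∃ s, s = δ / (4 + 2 * T) := ⟨_, rfl⟩
  have hs0 : 0 < s := by rw [hs]; positivity
  have hsδ : s * (4 + 2 * T) = δ := by rw [hs]; field_simp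
  have hsT : s * T ≤ 1 := by nlinarith
  refine ⟨Real.log (2 / δ) / s + Real.log (2 / δ), ?_⟩
  intro V _ _ p hp hpp f hf hf' η hη q hq hE
  have hp1 : p < 1 := by linarith
  let q' : V → ℝ := fun v => min (q v) p
  have hq' : ∀ v, q' v ∈ Set.Icc (0 : ℝ) 1 := fun v =>
    ⟨le_min (hq v).1 hp.le, (min_le_left _ _).trans (hq v).2⟩
  have hip : ∑ v, ip p (q' v) ≤ ∑ v, ip p (q v) := by
    refine Finset.sum_le_sum fun v _ => ?_
    rcases le_total (q v) p with h | h
    · simp [q', h]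
    · simp only [q', min_eq_right h, ip_self hp hp1]
      exact ip_nonneg hp hp1 (hq v).1 (hq v).2
  have hD : 0 ≤ ∑ v, ip p (q' v) :=
    Finset.sum_nonneg fun v _ => ip_nonneg hp hp1 (hq' v).1 (hq' v).2
  have ha : 0 ≤ η * expF f (fun _ => p) :=
    mul_nonneg hη (Finset.sum_nonneg fun ω _ =>
      mul_nonneg (pw_nonneg (fun _ => ⟨hp.le, hp1.le⟩) ω) (hf ω))
  have hE' : expF f q' ≤ (1 - δ) * (η * expF f (fun _ => p)) := by
    have := expF_mono hf (fun a b h => hf' a b h) hq' hq (fun v => min_le_left _ _)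
    nlinarith
  have hA := le_sum_pw_of_expF_le hf hq' ha hδ1 hE'
  generalize η * expF f (fun _ => p) = a at *
  have hprod : ∏ v, (q' v * (q' v / p) ^ s + (1 - q' v) * ((1 - q' v) / (1 - p)) ^ s) ≤
      Real.exp (s * ((1 + δ) * ∑ v, ip p (q' v))) := by
    rw [Finset.mul_sum, Finset.mul_sum, Real.exp_sum]
    refine Finset.prod_le_prod (fun v _ => ?_) fun v _ =>
      bernoulli_moment_le hp hpp hp₀ (hq' v).1 (min_le_right _ _) hT hs0 hsT hsδ.le
    have := (hq' v).1
    have : 0 ≤ 1 - q' v := sub_nonneg.2 (hq' v).2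
    have : 0 < 1 - p := by linarith
    positivity
  obtain ⟨D, hDdef⟩ : ∃ D, D = ∑ v, ip p (q' v) := ⟨_, rfl⟩
  rw [← hDdef] at hprod hip hD
  obtain ⟨m, hm⟩ : ∃ m, m = (1 + δ) * D + Real.log (2 / δ) / s := ⟨_, rfl⟩
  have hM := sum_pw_le_mul_add_prod hp hp1 hq' hs0 (Real.exp_pos m) (fun ω => f ω ≤ a)
  have hsm : Real.exp m ^ s = Real.exp (s * ((1 + δ) * D)) * (2 / δ) := by
    rw [← Real.exp_mul, ← Real.exp_log (show 0 < 2 / δ by positivity), ← Real.exp_add, hm]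
    congr 1
    field_simp
  have hrest : (∏ v, (q' v * (q' v / p) ^ s + (1 - q' v) * ((1 - q' v) / (1 - p)) ^ s)) /
      Real.exp m ^ s ≤ δ / 2 := by
    rw [hsm, div_le_iff₀ (by positivity)]
    refine hprod.trans (le_of_eq ?_)
    field_simp
  have hP : δ / 2 ≤ Real.exp m *
      ∑ ω : Finset V, if f ω ≤ a then pw (fun _ => p) ω else 0 := by linarith
  have hfin : Real.exp (-(m + Real.log (2 / δ))) ≤
      ∑ ω : Finset V, if f ω ≤ a then pw (fun _ => p) ω else 0 := by
    rw [Real.exp_neg, Real.exp_add, Real.exp_log (by positivity),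
      inv_le_iff_one_le_mul₀ (by positivity)]
    have := mul_le_mul_of_nonneg_right hP (show 0 ≤ 2 / δ by positivity)
    have e : δ / 2 * (2 / δ) = 1 := by field_simp
    linarith
  have hlog := Real.log_le_log (Real.exp_pos _) hfin
  rw [Real.log_exp] at hlog
  have : (1 + δ) * D ≤ (1 + ε) * ∑ v, ip p (q v) :=
    mul_le_mul (by linarith) hip hD (by linarith)
  linarith

end
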